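/- Let β ∈ (1,2) with terminating expansion of 1. For each m ∈ ℕ, ε > 0, probability vector p̄ on binary words of length m, and each cylinder C ⊆ [0,1) of the β-shift, one has liminf_{n→∞} N^s_∞(C ∩ G^{β,m}_{p̄}(n,ε)) ≥ |C|^s / (2 β^s Q(s,β)) for all 0 ≤ s < dim_H(G^{β,m}_{p̄}), where Q(s,β) = β^{−s} Σ_{i=0}^∞ (1−1/β)^{is}. -/

import Mathlib

open Set MeasureTheory Filter
open scoped ENNReal Classical

noncomputable section

/-- A similarity transformation of `ℝ`. -/
def IsSimilarity (f : ℝ → ℝ) : Prop := ∃ a b : ℝ, a ≠ 0 ∧ ∀ x, f x = a * x + b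

/-- Falconer's class `𝒢^s`: Gδ sets all of whose images under countably many
similarities intersect in a set of Hausdorff dimension at least `s`. -/
def falconerClass (s : ℝ) : Set (Set ℝ) :=
  {F | IsGδ F ∧ ∀ T : ℕ → ℝ → ℝ, (∀ i, IsSimilarity (T i)) →
    ENNReal.ofReal s ≤ dimH (⋂ i, T i '' F)}

/-- A probability vector indexed by a finite type. -/
def IsProbVector {ι : Type*} [Fintype ι] (p : ι → ℝ) : Prop :=
  (∀ i, 0 ≤ p i) ∧ ∑ i, p i = 1

/-- The β-transformation `x ↦ βx mod 1`. -/
def betaMap (β : ℝ) (x : ℝ) : ℝ := Int.fract (β * x)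

/-- The digits `d_n(x,β) = ⌊β f_β^n(x)⌋` of the greedy `β`-expansion. -/
def betaDigit (β x : ℝ) (n : ℕ) : ℤ := ⌊β * (betaMap β)^[n] x⌋

/-- The `β`-expansion of `1` terminates: `d(1,β) = j₀ … j_{k-1} 0^∞`. -/
def TerminatesAtOne (β : ℝ) : Prop := ∃ N : ℕ, ∀ n ≥ N, betaDigit β 1 n = 0

/-- The cylinder `[i₀ … i_{n-1}] ⊆ [0,1)` of the `β`-expansion. -/
def betaCyl (β : ℝ) (w : List ℤ) : Set ℝ :=
  {x ∈ Ico (0:ℝ) 1 | ∀ k (hk : k < w.length), betaDigit β x k = w.get ⟨k, hk⟩}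

/-- The outer measure `N^s_∞` from countable covers by cylinders of the `β`-expansion. -/
def betaCylMeasure (β s : ℝ) (A : Set ℝ) : ℝ≥0∞ :=
  ⨅ (c : ℕ → List ℤ) (_ : A ⊆ ⋃ i, betaCyl β (c i)),
    ∑' i, volume (betaCyl β (c i)) ^ s

/-- The empirical frequency `τ^β_w(x,n)/(n-m)` of the binary word `w` of length `m`
among the first `n` digits of the `β`-expansion of `x`. -/
def betaFreq (β : ℝ) {m : ℕ} (w : Fin m → Fin 2) (x : ℝ) (n : ℕ) : ℝ :=
  (((Finset.range (n - m)).filter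
      (fun i => ∀ k : Fin m, betaDigit β x (i + k) = ((w k : ℕ) : ℤ))).card : ℝ) / ((n - m : ℕ) : ℝ)

/-- `G^{β,m}_{p̄}`: points whose length-`m` word frequencies in the `β`-expansion
converge to `p̄`. -/
def betaGset (β : ℝ) (m : ℕ) (p : (Fin m → Fin 2) → ℝ) : Set ℝ :=
  {x ∈ Ico (0:ℝ) 1 | ∀ w : Fin m → Fin 2,
    Tendsto (fun n => betaFreq β w x n) atTop (nhds (p w))}

/-- `G^{β,m}_{p̄}(n,ε)`: points whose empirical frequencies at time `n` are within `ε`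
of `p̄` componentwise. -/
def betaGsetApprox (β : ℝ) (m : ℕ) (p : (Fin m → Fin 2) → ℝ) (n : ℕ) (ε : ℝ) : Set ℝ :=
  {x ∈ Ico (0:ℝ) 1 | ∀ w : Fin m → Fin 2, |betaFreq β w x n - p w| < ε}

/-- `p̄ ∈ A^{β,m}(x)`: `p̄` is an accumulation point of the empirical frequency vectors
of the `β`-expansion of `x`. -/
def betaFreqAccum (β : ℝ) (m : ℕ) (p : (Fin m → Fin 2) → ℝ) (x : ℝ) : Prop :=
  MapClusterPt p atTop (fun n => fun w => betaFreq β w x n)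

/-- The constant `Q(s,β) = β^{-s} Σ_{i=0}^∞ (1 - 1/β)^{is}`. -/
def Qconst (s β : ℝ) : ℝ := β ^ (-s) * ∑' i : ℕ, ((1 - 1/β) ^ i) ^ s

theorem betaMap_iterate_mem {β x : ℝ} (hx : x ∈ Ico (0:ℝ) 1) (n : ℕ) :
    (betaMap β)^[n] x ∈ Ico (0:ℝ) 1 := by
  cases n with
  | zero => simpa using hx
  | succ n =>
    rw [Function.iterate_succ_apply']
    exact ⟨Int.fract_nonneg _, Int.fract_lt_one _⟩

theorem betaDigit_add (β x : ℝ) (a i : ℕ) :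
    betaDigit β x (a + i) = betaDigit β ((betaMap β)^[a] x) i := by
  simp only [betaDigit, ← Function.iterate_add_apply, add_comm]

theorem measurable_betaMap (β : ℝ) : Measurable (betaMap β) := by
  unfold betaMap
  fun_prop

theorem measurable_betaDigit (β : ℝ) (n : ℕ) : Measurable (fun x => betaDigit β x n) := by
  have h := (measurable_betaMap β).iterate n
  unfold betaDigit
  exact Int.measurable_floor.comp (h.const_mul β)

theorem betaCyl_subset (β : ℝ) (u : List ℤ) : betaCyl β u ⊆ Ico 0 1 := fun _ hx => hx.1

theorem mem_betaCyl_iff {β x : ℝ} {u : List ℤ} :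
    x ∈ betaCyl β u ↔ x ∈ Ico (0:ℝ) 1 ∧ ∀ k (hk : k < u.length), betaDigit β x k = u[k] :=
  Iff.rfl

theorem measurableSet_betaCyl (β : ℝ) (u : List ℤ) : MeasurableSet (betaCyl β u) := by
  have : betaCyl β u = Ico (0:ℝ) 1 ∩ ⋂ k : Fin u.length, {x | betaDigit β x k = u.get k} := by
    ext x
    simp [betaCyl, Fin.forall_iff]
  rw [this]
  refine measurableSet_Ico.inter (MeasurableSet.iInter fun k => ?_)
  exact measurable_betaDigit β k (measurableSet_singleton _)

theorem mem_betaCyl_append {β x : ℝ} {u v : List ℤ} :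
    x ∈ betaCyl β (u ++ v) ↔ x ∈ betaCyl β u ∧ (betaMap β)^[u.length] x ∈ betaCyl β v := by
  simp only [mem_betaCyl_iff]
  constructor
  · rintro ⟨hx, h⟩
    refine ⟨⟨hx, fun k hk => ?_⟩, betaMap_iterate_mem hx _, fun k hk => ?_⟩
    · rw [h k (by simp; omega), List.getElem_append_left hk]
    · rw [← betaDigit_add, h (u.length + k) (by simp; omega)]
      simp
  · rintro ⟨⟨hx, h1⟩, -, h2⟩
    refine ⟨hx, fun k hk => ?_⟩
    rcases lt_or_ge k u.length with h | h
    · rw [h1 k h, List.getElem_append_left h]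
    · obtain ⟨j, rfl⟩ := Nat.exists_eq_add_of_le h
      rw [betaDigit_add, h2 j (by simp at hk; omega)]
      simp

theorem betaCyl_append_subset (β : ℝ) (u v : List ℤ) : betaCyl β (u ++ v) ⊆ betaCyl β u :=
  fun _ hx => (mem_betaCyl_append.1 hx).1

theorem mem_betaCyl_singleton {β x : ℝ} {d : ℤ} :
    x ∈ betaCyl β [d] ↔ x ∈ Ico (0:ℝ) 1 ∧ ⌊β * x⌋ = d := by
  simp [mem_betaCyl_iff, betaDigit]

/-- Two words with a common point in their cylinders are comparable for the prefix order. -/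
theorem exists_append_eq_of_mem_betaCyl {β x : ℝ} {u v : List ℤ} (hu : x ∈ betaCyl β u)
    (hv : x ∈ betaCyl β v) (h : u.length ≤ v.length) : ∃ v', v = u ++ v' := by
  refine ⟨v.drop u.length, ?_⟩
  have : u = v.take u.length := by
    apply List.ext_getElem
    · simp [h]
    · intro i h1 h2
      rw [List.getElem_take]
      exact (hu.2 i h1).symm.trans (hv.2 i (h1.trans_le h))
  nth_rewrite 1 [← List.take_append_drop u.length v]
  rw [← this]

theorem eq_of_mem_betaCyl {β x : ℝ} {u v : List ℤ} (hu : x ∈ betaCyl β u)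
    (hv : x ∈ betaCyl β v) (h : u.length = v.length) : u = v := by
  obtain ⟨v', rfl⟩ := exists_append_eq_of_mem_betaCyl hu hv h.le
  simp at h
  simp [h]

/-- The cylinder of `u` is an interval mapped affinely onto `[0, y)` by the iterate of order
`u.length` of the `β`-transformation. -/
def IsBranch (β : ℝ) (u : List ℤ) (y : ℝ) : Prop :=
  ∃ a, betaCyl β u = Ico a (a + y / β ^ u.length) ∧
    ∀ x ∈ betaCyl β u, (betaMap β)^[u.length] x = β ^ u.length * (x - a)

theorem IsBranch.nil (β : ℝ) : IsBranch β [] 1 :=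
  ⟨0, by ext; simp [betaCyl], by simp⟩

theorem IsBranch.snoc {β : ℝ} (hβ : 0 < β) {u : List ℤ} {y : ℝ} (h : IsBranch β u y) {d : ℤ}
    (hd : 0 ≤ d) : IsBranch β (u ++ [d]) (min 1 (β * y - d)) := by
  obtain ⟨a, h1, h2⟩ := h
  have hp : 0 < β ^ u.length := by positivity
  have hd' : (0:ℝ) ≤ d := by exact_mod_cast hd
  refine ⟨a + d / β ^ (u.length + 1), ?_, ?_⟩
  · ext x
    rw [mem_betaCyl_append, mem_betaCyl_singleton]
    have key : x ∈ Ico (a + d / β ^ (u.length + 1))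
        (a + d / β ^ (u.length + 1) + min 1 (β * y - d) / β ^ (u ++ [d]).length) ↔
        (d : ℝ) ≤ β * (β ^ u.length * (x - a)) ∧
          β * (β ^ u.length * (x - a)) < d + min 1 (β * y - d) := by
      rw [List.length_append, List.length_singleton, add_assoc, ← add_div, mem_Ico,
        ← le_sub_iff_add_le', ← sub_lt_iff_lt_add', div_le_iff₀ (by positivity),
        lt_div_iff₀ (by positivity)]
      have : β * (β ^ u.length * (x - a)) = (x - a) * β ^ (u.length + 1) := by ring
      rw [this]
    rw [key]
    constructor
    · rintro ⟨hx, -, hf⟩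
      rw [h2 x hx, Int.floor_eq_iff] at hf
      refine ⟨hf.1, ?_⟩
      rw [h1] at hx
      have : β ^ u.length * (x - a) < y := by
        rw [mul_comm, ← lt_div_iff₀ hp]; linarith [hx.2]
      rcases min_cases 1 (β * y - d) with ⟨e, -⟩ | ⟨e, -⟩ <;> rw [e]
      · exact hf.2
      · nlinarith
    · rintro ⟨k1, k2⟩
      have l1 := min_le_left 1 (β * y - d)
      have l2 := min_le_right 1 (β * y - d)
      have hx : x ∈ betaCyl β u := by
        rw [h1]
        constructor
        · by_contra! hh
          have : β * (β ^ u.length * (x - a)) < 0 :=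
            mul_neg_of_pos_of_neg hβ (mul_neg_of_pos_of_neg hp (by linarith))
          linarith
        · have : β * (β ^ u.length * (x - a)) < β * y := by linarith
          have := lt_of_mul_lt_mul_left this hβ.le
          rw [mul_comm, ← lt_div_iff₀ hp] at this
          linarith
      refine ⟨hx, betaMap_iterate_mem hx.1 _, ?_⟩
      rw [h2 x hx, Int.floor_eq_iff]
      exact ⟨k1, by linarith⟩
  · intro x hx
    rw [mem_betaCyl_append, mem_betaCyl_singleton] at hx
    obtain ⟨hx, -, hf⟩ := hx
    rw [List.length_append, List.length_singleton, Function.iterate_succ_apply', betaMap,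
      Int.fract, hf, h2 x hx]
    field_simp
    ring

theorem IsBranch.append_replicate {β : ℝ} (hβ : 1 < β) {u : List ℤ} {y : ℝ}
    (h : IsBranch β u y) (hy : y ≤ 1) (K : ℕ) :
    IsBranch β (u ++ List.replicate K 0) (min 1 (β ^ K * y)) := by
  induction K with
  | zero => simpa [hy] using h
  | succ K ih =>
    have := ih.snoc (by linarith) le_rfl
    rw [List.append_assoc, ← List.replicate_succ'] at this
    convert this using 1
    rcases le_total 1 (β ^ K * y) with h1 | h1
    · rw [min_eq_left h1, min_eq_left, min_eq_left]
      · push_cast; linarith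
      · rw [pow_succ]; nlinarith
    · rw [min_eq_right h1, pow_succ]; push_cast; congr 1; ring

/-- Endpoints of the images of cylinders lie in the orbit of `1`. -/
theorem exists_isBranch {β : ℝ} (hβ : 1 < β) {u : List ℤ} (hu : (betaCyl β u).Nonempty) :
    ∃ i : ℕ, 0 < (betaMap β)^[i] 1 ∧ IsBranch β u ((betaMap β)^[i] 1) := by
  induction u using List.reverseRecOn with
  | nil => exact ⟨0, by simp, by simpa using IsBranch.nil β⟩
  | append_singleton u d ih =>
    obtain ⟨x, hx⟩ := hu
    have hx' := mem_betaCyl_append.1 hx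
    obtain ⟨i, hi0, hi⟩ := ih ⟨x, hx'.1⟩
    have hd := mem_betaCyl_singleton.1 hx'.2
    have hd0 : 0 ≤ d := by
      rw [← hd.2]; exact Int.floor_nonneg.2 (mul_nonneg (by linarith) hd.1.1)
    have hb := hi.snoc (by linarith) hd0
    have hpos : 0 < min 1 (β * (betaMap β)^[i] 1 - d) := by
      obtain ⟨a, ha, -⟩ := hb
      rw [ha] at hx
      by_contra! hh
      have : min 1 (β * (betaMap β)^[i] 1 - d) / β ^ (u ++ [d]).length ≤ 0 :=
        div_nonpos_of_nonpos_of_nonneg hh (by positivity)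
      linarith [hx.1, hx.2]
    rcases le_total 1 (β * (betaMap β)^[i] 1 - d) with h1 | h1
    · rw [min_eq_left h1] at hb
      exact ⟨0, by simp, by simpa using hb⟩
    · rcases h1.eq_or_lt with h1 | h1
      · rw [h1, min_self] at hb
        exact ⟨0, by simp, by simpa using hb⟩
      · rw [min_eq_right h1.le] at hb hpos
        have : (betaMap β)^[i + 1] 1 = β * (betaMap β)^[i] 1 - d := by
          rw [Function.iterate_succ_apply', betaMap, Int.fract_eq_iff]
          exact ⟨hpos.le, h1, d, by ring⟩
        exact ⟨i + 1, by rwa [this], by rwa [this]⟩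

theorem betaMap_iterate_one_le {β : ℝ} (i : ℕ) : (betaMap β)^[i] 1 ≤ 1 := by
  cases i with
  | zero => simp
  | succ n =>
    rw [Function.iterate_succ_apply']
    exact (Int.fract_lt_one _).le

theorem exists_iterate_one_eq_zero {β : ℝ} (hβ : 1 < β) (h : TerminatesAtOne β) :
    ∃ N, ∀ n ≥ N, (betaMap β)^[n] 1 = 0 := by
  obtain ⟨N, hN⟩ := h
  have step : ∀ n ≥ N, (betaMap β)^[n + 1] 1 = β * (betaMap β)^[n] 1 := by
    intro n hn
    have := hN n hn
    rw [betaDigit] at this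
    rw [Function.iterate_succ_apply', betaMap, Int.fract, this]
    simp
  have pow : ∀ n ≥ N, ∀ j, (betaMap β)^[n + j] 1 = β ^ j * (betaMap β)^[n] 1 := by
    intro n hn j
    induction j with
    | zero => simp
    | succ j ih => rw [← add_assoc, step _ (by omega), ih]; ring
  refine ⟨N + 1, fun n hn => ?_⟩
  have hnn : 0 ≤ (betaMap β)^[n] 1 := by
    obtain ⟨n, rfl⟩ : ∃ q, n = q + 1 := ⟨n - 1, by omega⟩
    rw [Function.iterate_succ_apply']
    exact Int.fract_nonneg _
  by_contra hne
  have hpos := lt_of_le_of_ne hnn (Ne.symm hne)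
  obtain ⟨j, hj⟩ := pow_unbounded_of_one_lt (1 / (betaMap β)^[n] 1) hβ
  rw [div_lt_iff₀ hpos, ← pow n (by omega)] at hj
  exact absurd hj (betaMap_iterate_one_le _).not_gt

theorem exists_pow_mul_iterate_one_ge {β : ℝ} (hβ : 1 < β) (h : TerminatesAtOne β) :
    ∃ K : ℕ, ∀ i, 0 < (betaMap β)^[i] 1 → 1 ≤ β ^ K * (betaMap β)^[i] 1 := by
  obtain ⟨N, hN⟩ := exists_iterate_one_eq_zero hβ h
  have : ∀ i, ∃ K : ℕ, 0 < (betaMap β)^[i] 1 → 1 ≤ β ^ K * (betaMap β)^[i] 1 := by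
    intro i
    rcases le_or_gt ((betaMap β)^[i] 1) 0 with h | h
    · exact ⟨0, fun h' => absurd h' h.not_gt⟩
    · obtain ⟨j, hj⟩ := pow_unbounded_of_one_lt (1 / (betaMap β)^[i] 1) hβ
      rw [div_lt_iff₀ h] at hj
      exact ⟨j, fun _ => hj.le⟩
  choose f hf using this
  refine ⟨(Finset.range N).sup f, fun i hi => ?_⟩
  have hiN : i < N := by
    by_contra! hh
    exact hi.ne' (hN i hh)
  refine (hf i hi).trans (mul_le_mul_of_nonneg_right ?_ hi.le)
  exact pow_le_pow_right₀ hβ.le (Finset.le_sup (f := f) (Finset.mem_range.2 hiN))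

/-- Appending `K` zeros to the word of any nonempty cylinder yields a full cylinder. -/
def ZerosFill (β : ℝ) (K : ℕ) : Prop :=
  ∀ u : List ℤ, (betaCyl β u).Nonempty → IsBranch β (u ++ List.replicate K 0) 1

theorem exists_zerosFill {β : ℝ} (hβ : 1 < β) (h : TerminatesAtOne β) :
    ∃ K, ZerosFill β K := by
  obtain ⟨K, hK⟩ := exists_pow_mul_iterate_one_ge hβ h
  refine ⟨K, fun u hu => ?_⟩
  obtain ⟨i, hi0, hi⟩ := exists_isBranch hβ hu
  have := hi.append_replicate hβ (betaMap_iterate_one_le i) K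
  rwa [min_eq_left (hK i hi0)] at this

/-! ### Volumes of cylinders -/

theorem volume_betaCyl_ne_top (β : ℝ) (u : List ℤ) : volume (betaCyl β u) ≠ ⊤ :=
  measure_ne_top_of_subset (betaCyl_subset β u) (by simp)

theorem IsBranch.volume_inter_preimage {β : ℝ} (hβ : 0 < β) {u : List ℤ} (h : IsBranch β u 1)
    {X : Set ℝ} (hX : X ⊆ Ico 0 1) :
    volume.real (betaCyl β u ∩ (betaMap β)^[u.length] ⁻¹' X) =
      (β ^ u.length)⁻¹ * volume.real X := by
  obtain ⟨a, h1, h2⟩ := h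
  have hp : 0 < β ^ u.length := by positivity
  have : betaCyl β u ∩ (betaMap β)^[u.length] ⁻¹' X =
      (fun x => x - a) ⁻¹' ((fun x => β ^ u.length * x) ⁻¹' X) := by
    ext x
    simp only [mem_inter_iff, mem_preimage]
    constructor
    · rintro ⟨hx, hx'⟩
      rwa [h2 x hx] at hx'
    · intro hx
      have hx' : x ∈ betaCyl β u := by
        have := hX hx
        rw [h1]
        constructor
        · have := nonneg_of_mul_nonneg_right this.1 hp
          linarith
        · have := this.2
          rw [mul_comm, ← lt_div_iff₀ hp] at this
          linarith
      exact ⟨hx', by rwa [h2 x hx']⟩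
  simp only [sub_eq_add_neg] at this
  rw [this, measureReal_def, measure_preimage_add_right, Real.volume_preimage_mul_left hp.ne',
    ENNReal.toReal_mul, ENNReal.toReal_ofReal (abs_nonneg _), abs_of_pos (inv_pos.2 hp),
    measureReal_def]

theorem IsBranch.volume_append {β : ℝ} (hβ : 0 < β) {u : List ℤ} (h : IsBranch β u 1)
    (v : List ℤ) :
    volume.real (betaCyl β (u ++ v)) = (β ^ u.length)⁻¹ * volume.real (betaCyl β v) := by
  rw [← h.volume_inter_preimage hβ (betaCyl_subset β v)]
  congr 1
  ext x
  exact mem_betaCyl_append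

theorem volume_betaCyl_nil (β : ℝ) : volume.real (betaCyl β []) = 1 := by
  have : betaCyl β [] = Ico 0 1 := by ext; simp [betaCyl]
  simp [this, measureReal_def]

theorem IsBranch.volume_eq {β : ℝ} (hβ : 0 < β) {u : List ℤ} (h : IsBranch β u 1) :
    volume.real (betaCyl β u) = (β ^ u.length)⁻¹ := by
  simpa [volume_betaCyl_nil] using h.volume_append hβ []

theorem volume_betaCyl_le {β : ℝ} (hβ : 1 < β) (u : List ℤ) :
    volume.real (betaCyl β u) ≤ (β ^ u.length)⁻¹ := by
  rcases (betaCyl β u).eq_empty_or_nonempty with h | h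
  · rw [h]; simp; positivity
  · obtain ⟨i, hi0, a, h1, -⟩ := exists_isBranch hβ h
    rw [h1, measureReal_def, Real.volume_Ico, add_sub_cancel_left,
      ENNReal.toReal_ofReal (by positivity), div_eq_mul_inv]
    exact mul_le_of_le_one_left (by positivity) (betaMap_iterate_one_le i)

theorem ediam_betaCyl_le {β : ℝ} (hβ : 1 < β) (u : List ℤ) :
    Metric.ediam (betaCyl β u) ≤ ENNReal.ofReal (β ^ u.length)⁻¹ := by
  rcases (betaCyl β u).eq_empty_or_nonempty with h | h
  · simp [h]
  · obtain ⟨i, hi0, a, h1, -⟩ := exists_isBranch hβ h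
    rw [h1, Real.ediam_Ico, add_sub_cancel_left, div_eq_mul_inv]
    exact ENNReal.ofReal_le_ofReal
      (mul_le_of_le_one_left (by positivity) (betaMap_iterate_one_le i))

theorem ZerosFill.le_volume {β : ℝ} (hβ : 1 < β) {K : ℕ} (hK : ZerosFill β K) {u : List ℤ}
    (hu : (betaCyl β u).Nonempty) :
    (β ^ (u.length + K))⁻¹ ≤ volume.real (betaCyl β u) := by
  have := (hK u hu).volume_eq (by linarith)
  rw [List.length_append, List.length_replicate] at this
  rw [← this]
  exact measureReal_mono (betaCyl_append_subset β _ _) (volume_betaCyl_ne_top β u)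

/-- The words of length `k` with nonempty cylinder. -/
def admissibleWords (β : ℝ) (k : ℕ) : Set (List ℤ) :=
  {v | v.length = k ∧ (betaCyl β v).Nonempty}

theorem betaDigit_mem {β x : ℝ} (hβ1 : 1 < β) (hβ2 : β < 2) (hx : x ∈ Ico (0:ℝ) 1) (n : ℕ) :
    betaDigit β x n ∈ Icc (0:ℤ) 1 := by
  have h := betaMap_iterate_mem (β := β) hx n
  constructor
  · exact Int.floor_nonneg.2 (mul_nonneg (by linarith) h.1)
  · refine Int.lt_add_one_iff.1 (Int.floor_lt.2 ?_)
    push_cast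
    nlinarith [h.1, h.2]

theorem finite_admissibleWords {β : ℝ} (hβ1 : 1 < β) (hβ2 : β < 2) (k : ℕ) :
    (admissibleWords β k).Finite := by
  refine ((Set.finite_range (fun f : Fin k → Fin 2 =>
    List.ofFn (fun i => ((f i : ℕ) : ℤ)))).subset ?_)
  rintro v ⟨rfl, x, hx⟩
  have h01 : ∀ i : Fin v.length, ∃ q : Fin 2, ((q : ℕ) : ℤ) = v.get i := by
    intro i
    have h := betaDigit_mem hβ1 hβ2 hx.1 i
    rw [hx.2 i i.2] at h
    have h' : v.get i = 0 ∨ v.get i = 1 := by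
      have h0 := h.1
      have h1 := h.2
      simp only [Fin.eta] at h0 h1
      omega
    rcases h' with h' | h'
    · exact ⟨0, by rw [h']; rfl⟩
    · exact ⟨1, by rw [h']; rfl⟩
  choose f hf using h01
  exact ⟨f, by simp only [hf]; exact List.ofFn_get v⟩

theorem exists_mem_admissibleWords {β x : ℝ} (hx : x ∈ Ico (0:ℝ) 1) (k : ℕ) :
    ∃ v ∈ admissibleWords β k, x ∈ betaCyl β v := by
  have : x ∈ betaCyl β (List.ofFn (fun i : Fin k => betaDigit β x i)) :=
    mem_betaCyl_iff.2 ⟨hx, by simp⟩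
  exact ⟨_, ⟨by simp, x, this⟩, this⟩

/-- The points whose first `j` blocks are taken from the dictionary `𝒢`. -/
def blockSet (β : ℝ) (𝒢 : Finset (List ℤ)) : ℕ → Set ℝ
  | 0 => Ico 0 1
  | j + 1 => ⋃ u ∈ 𝒢, betaCyl β u ∩ (betaMap β)^[u.length] ⁻¹' blockSet β 𝒢 j

theorem blockSet_subset (β : ℝ) (𝒢 : Finset (List ℤ)) (j : ℕ) : blockSet β 𝒢 j ⊆ Ico 0 1 := by
  cases j with
  | zero => exact subset_rfl
  | succ j => exact iUnion₂_subset fun u _ => inter_subset_left.trans (betaCyl_subset β u)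

theorem measurableSet_blockSet (β : ℝ) (𝒢 : Finset (List ℤ)) (j : ℕ) :
    MeasurableSet (blockSet β 𝒢 j) := by
  induction j with
  | zero => exact measurableSet_Ico
  | succ j ih =>
    exact Finset.measurableSet_biUnion _ fun u _ =>
      (measurableSet_betaCyl β u).inter ((measurable_betaMap β).iterate _ ih)

theorem disjoint_betaCyl {β : ℝ} {u v : List ℤ} (h : u.length = v.length) (hne : u ≠ v) :
    Disjoint (betaCyl β u) (betaCyl β v) :=
  Set.disjoint_left.2 fun _ hu hv => hne (eq_of_mem_betaCyl hu hv h)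

theorem volume_blockSet {β : ℝ} (hβ : 0 < β) {𝒢 : Finset (List ℤ)} {k : ℕ}
    (hlen : ∀ u ∈ 𝒢, u.length = k) (hfull : ∀ u ∈ 𝒢, IsBranch β u 1) (j : ℕ) :
    volume.real (blockSet β 𝒢 j) = (𝒢.card * (β ^ k)⁻¹) ^ j := by
  induction j with
  | zero => simp [blockSet, measureReal_def]
  | succ j ih =>
    have htop : ∀ u ∈ 𝒢, volume (betaCyl β u ∩ (betaMap β)^[u.length] ⁻¹' blockSet β 𝒢 j) ≠ ⊤ :=
      fun u _ => measure_ne_top_of_subset inter_subset_left (volume_betaCyl_ne_top β u)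
    rw [blockSet, measureReal_biUnion_finset (h := htop)]
    · rw [Finset.sum_congr rfl (fun u hu => by
        rw [(hfull u hu).volume_inter_preimage hβ (blockSet_subset β 𝒢 j), ih, hlen u hu])]
      rw [Finset.sum_const, nsmul_eq_mul, pow_succ]
      ring
    · intro u hu v hv hne
      exact (disjoint_betaCyl ((hlen u hu).trans (hlen v hv).symm) hne).mono
        inter_subset_left inter_subset_left
    · intro u _
      exact (measurableSet_betaCyl β u).inter
        ((measurable_betaMap β).iterate _ (measurableSet_blockSet β 𝒢 j))

theorem one_le_mul_rpow {β s A V : ℝ} (hβ : 1 < β) (hs : 0 ≤ s) {q : ℕ}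
    (hV : (β ^ q)⁻¹ ≤ V) (hA : (β ^ q) ^ s ≤ A) : 1 ≤ A * V ^ s := by
  have hp : 0 < β ^ q := by positivity
  calc (1:ℝ) = (β ^ q) ^ s * ((β ^ q)⁻¹) ^ s := by
        rw [← Real.mul_rpow hp.le (by positivity), mul_inv_cancel₀ hp.ne', Real.one_rpow]
    _ ≤ A * V ^ s := by
        have := Real.rpow_le_rpow (by positivity) hV hs
        gcongr
        exact (by positivity : (0:ℝ) ≤ (β ^ q) ^ s).trans hA

/-- Pulling a mass distribution estimate back to a full cylinder. -/
theorem IsBranch.volume_inter_le {β s A r : ℝ} {K : ℕ} (hβ : 1 < β) (hK : ZerosFill β K)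
    (hs : 0 ≤ s) {X : Set ℝ} (hX : X ⊆ Ico 0 1) (hr : volume.real X ≤ r)
    (hA : (β ^ K) ^ s ≤ A)
    (hXd : ∀ d, volume.real (betaCyl β d ∩ X) ≤ A * r * volume.real (betaCyl β d) ^ s)
    {u : List ℤ} (hu : IsBranch β u 1) (d : List ℤ) :
    volume.real (betaCyl β d ∩ (betaCyl β u ∩ (betaMap β)^[u.length] ⁻¹' X)) ≤
      A * r * (β ^ u.length)⁻¹ * (β ^ u.length) ^ s * volume.real (betaCyl β d) ^ s := by
  have hβ0 : 0 < β := by linarith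
  have hp : 0 < β ^ u.length := by positivity
  have hr0 : 0 ≤ r := measureReal_nonneg.trans hr
  have hA0 : 0 ≤ A := (by positivity : (0:ℝ) ≤ (β ^ K) ^ s).trans hA
  rcases (betaCyl β d ∩ betaCyl β u).eq_empty_or_nonempty with h | ⟨x, hxd, hxu⟩
  · rw [← inter_assoc, h]
    simp
    positivity
  rcases le_total u.length d.length with hl | hl
  · obtain ⟨d', rfl⟩ := exists_append_eq_of_mem_betaCyl hxu hxd hl
    have e : betaCyl β (u ++ d') ∩ (betaCyl β u ∩ (betaMap β)^[u.length] ⁻¹' X) =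
        betaCyl β u ∩ (betaMap β)^[u.length] ⁻¹' (betaCyl β d' ∩ X) := by
      ext y
      simp only [mem_inter_iff, mem_betaCyl_append, mem_preimage]
      tauto
    rw [e, hu.volume_inter_preimage hβ0 (inter_subset_right.trans hX), hu.volume_append hβ0,
      Real.mul_rpow (by positivity) measureReal_nonneg]
    have : (β ^ u.length) ^ s * ((β ^ u.length)⁻¹) ^ s = 1 := by
      rw [← Real.mul_rpow hp.le (by positivity), mul_inv_cancel₀ hp.ne', Real.one_rpow]
    calc _ ≤ (β ^ u.length)⁻¹ * (A * r * volume.real (betaCyl β d') ^ s) := by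
          gcongr; exact hXd d'
      _ = (β ^ u.length)⁻¹ * (A * r * volume.real (betaCyl β d') ^ s) *
          ((β ^ u.length) ^ s * ((β ^ u.length)⁻¹) ^ s) := by rw [this, mul_one]
      _ = _ := by ring
  · calc _ ≤ volume.real (betaCyl β u ∩ (betaMap β)^[u.length] ⁻¹' X) :=
          measureReal_mono inter_subset_right
            (measure_ne_top_of_subset inter_subset_left (volume_betaCyl_ne_top β u))
      _ = (β ^ u.length)⁻¹ * volume.real X := hu.volume_inter_preimage hβ0 hX
      _ ≤ (β ^ u.length)⁻¹ * r * 1 := by rw [mul_one]; gcongr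
      _ ≤ (β ^ u.length)⁻¹ * r *
          ((A * (β ^ u.length) ^ s) * volume.real (betaCyl β d) ^ s) := by
          gcongr
          refine one_le_mul_rpow hβ hs (q := u.length + K) ?_ ?_
          · refine le_trans ?_ (hK.le_volume hβ ⟨x, hxd⟩)
            gcongr
            exact hβ.le
          · rw [pow_add, Real.mul_rpow hp.le (by positivity), mul_comm]
            gcongr
      _ = _ := by ring

theorem volume_betaCyl_le_one (β : ℝ) (u : List ℤ) : volume.real (betaCyl β u) ≤ 1 := by
  refine (measureReal_mono (betaCyl_subset β u) (by simp)).trans ?_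
  simp [measureReal_def]

theorem volume_inter_blockSet_le {β s A : ℝ} {K k : ℕ} (hβ : 1 < β) (hK : ZerosFill β K)
    (hs : 0 ≤ s) (hs1 : s ≤ 1) {𝒢 : Finset (List ℤ)}
    (hlen : ∀ u ∈ 𝒢, u.length = k) (hfull : ∀ u ∈ 𝒢, IsBranch β u 1)
    (hcard : (β ^ k) ^ s ≤ 𝒢.card) (hA : (β ^ (k + K)) ^ s ≤ A) (j : ℕ) (d : List ℤ) :
    volume.real (betaCyl β d ∩ blockSet β 𝒢 j) ≤
      A * (𝒢.card * (β ^ k)⁻¹) ^ j * volume.real (betaCyl β d) ^ s := by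
  have hβ0 : 0 < β := by linarith
  have hA1 : (β ^ K) ^ s ≤ A := by
    refine le_trans ?_ hA
    gcongr
    · exact hβ.le
    · omega
  have hA2 : 1 ≤ A := by
    refine le_trans ?_ hA1
    exact Real.one_le_rpow (one_le_pow₀ hβ.le) hs
  induction j generalizing d with
  | zero =>
    rw [pow_zero, mul_one]
    calc volume.real (betaCyl β d ∩ blockSet β 𝒢 0)
        ≤ volume.real (betaCyl β d) :=
          measureReal_mono inter_subset_left (volume_betaCyl_ne_top β d)
      _ ≤ volume.real (betaCyl β d) ^ s :=
          Real.self_le_rpow_of_le_one measureReal_nonneg (volume_betaCyl_le_one β d) hs1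
      _ ≤ A * volume.real (betaCyl β d) ^ s :=
          le_mul_of_one_le_left (by positivity) hA2
  | succ j ih =>
    rcases (betaCyl β d).eq_empty_or_nonempty with h | hne
    · rw [h]; simp; positivity
    rcases le_or_gt k d.length with hl | hl
    · by_cases hex : ∃ u ∈ 𝒢, (betaCyl β d ∩ betaCyl β u).Nonempty
      · obtain ⟨u, hu, x, hxd, hxu⟩ := hex
        obtain ⟨d', rfl⟩ := exists_append_eq_of_mem_betaCyl hxu hxd (by rw [hlen u hu]; exact hl)
        have hsub : betaCyl β (u ++ d') ∩ blockSet β 𝒢 (j + 1) ⊆ betaCyl β (u ++ d') ∩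
            (betaCyl β u ∩ (betaMap β)^[u.length] ⁻¹' blockSet β 𝒢 j) := by
          rintro y ⟨hyd, hy⟩
          obtain ⟨u', hu', hy'⟩ := mem_iUnion₂.1 hy
          have := eq_of_mem_betaCyl hy'.1 (betaCyl_append_subset β _ _ hyd)
            ((hlen u' hu').trans (hlen u hu).symm)
          subst this
          exact ⟨hyd, hy'⟩
        calc _ ≤ _ := measureReal_mono hsub
              (measure_ne_top_of_subset inter_subset_left (volume_betaCyl_ne_top β _))
          _ ≤ _ := (hfull u hu).volume_inter_le hβ hK hs (blockSet_subset β 𝒢 j)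
              (volume_blockSet hβ0 hlen hfull j).le hA1 ih _
          _ ≤ _ := by
              rw [hlen u hu, pow_succ]
              have : A * (𝒢.card * (β ^ k)⁻¹) ^ j * (β ^ k)⁻¹ * (β ^ k) ^ s ≤
                A * (𝒢.card * (β ^ k)⁻¹) ^ j * (β ^ k)⁻¹ * 𝒢.card := by gcongr
              refine (mul_le_mul_of_nonneg_right this (by positivity)).trans_eq ?_
              ring
      · have : betaCyl β d ∩ blockSet β 𝒢 (j + 1) = ∅ := by
          refine eq_empty_of_forall_notMem ?_
          rintro y ⟨hyd, hy⟩
          obtain ⟨u', hu', hy'⟩ := mem_iUnion₂.1 hy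
          exact hex ⟨u', hu', y, hyd, hy'.1⟩
        rw [this]; simp; positivity
    · calc _ ≤ volume.real (blockSet β 𝒢 (j + 1)) :=
            measureReal_mono inter_subset_right
              (measure_ne_top_of_subset (blockSet_subset β 𝒢 _) (by simp))
        _ = (𝒢.card * (β ^ k)⁻¹) ^ (j + 1) * 1 := by
            rw [volume_blockSet hβ0 hlen hfull, mul_one]
        _ ≤ (𝒢.card * (β ^ k)⁻¹) ^ (j + 1) * (A * volume.real (betaCyl β d) ^ s) := by
            gcongr
            refine one_le_mul_rpow hβ hs (q := k + K) ?_ hA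
            refine le_trans ?_ (hK.le_volume hβ hne)
            gcongr
            exact hβ.le
        _ = _ := by ring

theorem ZerosFill.measure_le {β s A r : ℝ} {K L : ℕ} (hβ1 : 1 < β)
    (hK : ZerosFill β K) (hs : 0 < s) (hs1 : s < 1) {w : List ℤ}
    {X : Set ℝ} (hX : X ⊆ Ico 0 1) (hr : volume.real X = r) (hr0 : 0 < r)
    (hA : (β ^ K) ^ s ≤ A)
    (hXd : ∀ d, volume.real (betaCyl β d ∩ X) ≤ A * r * volume.real (betaCyl β d) ^ s)
    (hL : A * (β ^ K) ^ s * ((β ^ L)⁻¹) ^ (1 - s) ≤ volume.real (betaCyl β w) ^ (1 - s))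
    {V : Finset (List ℤ)} (hV : ∀ v ∈ V, v ∈ admissibleWords β L ∧ ∃ v', v = w ++ v')
    (d : List ℤ) :
    ∑ v ∈ V, volume.real (betaCyl β v) * β ^ (L + K) / r *
      volume.real (betaCyl β d ∩ (betaCyl β (v ++ List.replicate K 0) ∩
        (betaMap β)^[L + K] ⁻¹' X)) ≤
      volume.real (betaCyl β w) ^ (1 - s) * volume.real (betaCyl β d) ^ s := by
  have hβ0 : 0 < β := by linarith
  set F : List ℤ → Set ℝ := fun v => betaCyl β (v ++ List.replicate K 0) ∩
        (betaMap β)^[L + K] ⁻¹' X with hF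
  have hFv : ∀ v, F v ⊆ betaCyl β v := fun v =>
    inter_subset_left.trans (betaCyl_append_subset β _ _)
  have hlen : ∀ v ∈ V, (v ++ List.replicate K (0:ℤ)).length = L + K := by
    intro v hv
    rw [List.length_append, List.length_replicate, (hV v hv).1.1]
  rcases le_or_gt d.length L with hl | hl
  · have hterm : ∀ v ∈ V, volume.real (betaCyl β v) * β ^ (L + K) / r *
        volume.real (betaCyl β d ∩ F v) ≤ volume.real (betaCyl β d ∩ betaCyl β v) := by
      intro v hv
      rcases (betaCyl β d ∩ betaCyl β v).eq_empty_or_nonempty with h | ⟨x, hxd, hxv⟩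
      · have : betaCyl β d ∩ F v = ∅ :=
          subset_empty_iff.1 ((inter_subset_inter_right _ (hFv v)).trans_eq h)
        simp [this]
      · obtain ⟨v', hv'⟩ := exists_append_eq_of_mem_betaCyl hxd hxv (by rw [(hV v hv).1.1]; exact hl)
        have e : betaCyl β d ∩ betaCyl β v = betaCyl β v :=
          inter_eq_right.2 (hv' ▸ betaCyl_append_subset β _ _)
        have hvol := (hK v (hV v hv).1.2).volume_inter_preimage hβ0 hX
        rw [hlen v hv, hr] at hvol
        have hle : volume.real (betaCyl β d ∩ F v) ≤ (β ^ (L + K))⁻¹ * r := by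
          rw [← hvol]
          exact measureReal_mono inter_subset_right
            (measure_ne_top_of_subset (hFv v) (volume_betaCyl_ne_top β v))
        rw [e]
        calc _ ≤ volume.real (betaCyl β v) * β ^ (L + K) / r * ((β ^ (L + K))⁻¹ * r) := by
              gcongr
          _ = _ := by field_simp
    have hdisj : ∑ v ∈ V, volume.real (betaCyl β d ∩ betaCyl β v) =
        volume.real (⋃ v ∈ V, betaCyl β d ∩ betaCyl β v) := by
      rw [measureReal_biUnion_finset (h := fun v _ =>
        measure_ne_top_of_subset inter_subset_right (volume_betaCyl_ne_top β v))]
      · intro u hu v hv hne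
        exact (disjoint_betaCyl ((hV u hu).1.1.trans (hV v hv).1.1.symm) hne).mono
          inter_subset_right inter_subset_right
      · intro u _
        exact (measurableSet_betaCyl β d).inter (measurableSet_betaCyl β u)
    have hsubd : (⋃ v ∈ V, betaCyl β d ∩ betaCyl β v) ⊆ betaCyl β d :=
      iUnion₂_subset fun v _ => inter_subset_left
    have hsubw : (⋃ v ∈ V, betaCyl β d ∩ betaCyl β v) ⊆ betaCyl β w := by
      refine iUnion₂_subset fun v hv => inter_subset_right.trans ?_
      obtain ⟨v', hv'⟩ := (hV v hv).2
      exact hv' ▸ betaCyl_append_subset β _ _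
    set y := volume.real (⋃ v ∈ V, betaCyl β d ∩ betaCyl β v)
    have hy0 : 0 ≤ y := measureReal_nonneg
    have hyd : y ≤ volume.real (betaCyl β d) := measureReal_mono hsubd (volume_betaCyl_ne_top β d)
    have hyw : y ≤ volume.real (betaCyl β w) := measureReal_mono hsubw (volume_betaCyl_ne_top β w)
    calc _ ≤ y := (Finset.sum_le_sum hterm).trans_eq hdisj
      _ = y ^ (1 - s) * y ^ s := by
          rw [← Real.rpow_add' hy0 (by norm_num), sub_add_cancel, Real.rpow_one]
      _ ≤ _ := by
          gcongr
  · by_cases hex : ∃ v ∈ V, (betaCyl β d ∩ betaCyl β v).Nonempty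
    · obtain ⟨v, hv, x, hxd, hxv⟩ := hex
      rw [Finset.sum_eq_single_of_mem v hv]
      · have hb := (hK v (hV v hv).1.2).volume_inter_le hβ1 hK hs.le hX hr.le hA hXd d
        rw [hlen v hv] at hb
        have hvL : volume.real (betaCyl β v) ≤ (β ^ L)⁻¹ := by
          have := volume_betaCyl_le hβ1 v
          rwa [(hV v hv).1.1] at this
        have hA0 : 0 ≤ A := (by positivity : (0:ℝ) ≤ (β ^ K) ^ s).trans hA
        calc _ ≤ (β ^ L)⁻¹ * β ^ (L + K) / r *
              (A * r * (β ^ (L + K))⁻¹ * (β ^ (L + K)) ^ s * volume.real (betaCyl β d) ^ s) := by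
              gcongr
          _ = A * ((β ^ L)⁻¹ * (β ^ (L + K)) ^ s) * volume.real (betaCyl β d) ^ s := by
              field_simp
          _ = A * (β ^ K) ^ s * ((β ^ L)⁻¹) ^ (1 - s) * volume.real (betaCyl β d) ^ s := by
              have hp : 0 < β ^ L := by positivity
              rw [pow_add, Real.mul_rpow hp.le (by positivity), Real.inv_rpow hp.le,
                Real.rpow_sub hp, Real.rpow_one]
              field_simp
          _ ≤ _ := by gcongr
      · intro v' hv' hne
        have : betaCyl β d ∩ F v' = ∅ := by
          refine eq_empty_of_forall_notMem ?_
          rintro y ⟨hyd, hy⟩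
          obtain ⟨d', rfl⟩ := exists_append_eq_of_mem_betaCyl hxv hxd
            (by rw [(hV v hv).1.1]; exact hl.le)
          exact hne (eq_of_mem_betaCyl (hFv _ hy) (betaCyl_append_subset β _ _ hyd)
            ((hV v' hv').1.1.trans (hV v hv).1.1.symm))
        simp only [hF] at this
        simp [this]
    · rw [Finset.sum_eq_zero]
      · positivity
      · intro v hv
        have : betaCyl β d ∩ F v = ∅ := by
          refine eq_empty_of_forall_notMem ?_
          rintro y ⟨hyd, hy⟩
          exact hex ⟨v, hv, y, hyd, hFv _ hy⟩
        simp only [hF] at this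
        simp [this]

/-- A lower bound for the cylinder content of a set that contains a full copy of a set
satisfying a mass distribution estimate in every cylinder of generation `L` inside `w`. -/
theorem ZerosFill.le_betaCylMeasure {β s A r : ℝ} {K L : ℕ} (hβ1 : 1 < β) (hβ2 : β < 2)
    (hK : ZerosFill β K) (hs : 0 < s) (hs1 : s < 1) {w : List ℤ} (hwL : w.length ≤ L)
    {X : Set ℝ} (hX : X ⊆ Ico 0 1) (hr : volume.real X = r) (hr0 : 0 < r)
    (hA : (β ^ K) ^ s ≤ A)
    (hXd : ∀ d, volume.real (betaCyl β d ∩ X) ≤ A * r * volume.real (betaCyl β d) ^ s)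
    (hL : A * (β ^ K) ^ s * ((β ^ L)⁻¹) ^ (1 - s) ≤ volume.real (betaCyl β w) ^ (1 - s))
    {G : Set ℝ} (hG : ∀ x ∈ betaCyl β w, (betaMap β)^[L + K] x ∈ X → x ∈ G) :
    volume (betaCyl β w) ^ s ≤ betaCylMeasure β s G := by
  have hβ0 : 0 < β := by linarith
  refine le_iInf₂ fun c hc => ?_
  rcases eq_or_ne (volume (betaCyl β w)) 0 with hw0 | hw0
  · rw [hw0, ENNReal.zero_rpow_of_pos hs]
    exact zero_le
  have hwtop := volume_betaCyl_ne_top β w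
  let V := (finite_admissibleWords hβ1 hβ2 L).toFinset.filter (fun v => ∃ v', v = w ++ v')
  have hV : ∀ v ∈ V, v ∈ admissibleWords β L ∧ ∃ v', v = w ++ v' := by
    intro v hv
    simpa [V] using hv
  let F : List ℤ → Set ℝ := fun v => betaCyl β (v ++ List.replicate K 0) ∩
        (betaMap β)^[L + K] ⁻¹' X
  let lam : List ℤ → ℝ := fun v => volume.real (betaCyl β v) * β ^ (L + K) / r
  have hlam : ∀ v, 0 ≤ lam v := fun v => by positivity
  have hFtop : ∀ v, volume (F v) ≠ ⊤ := fun v =>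
    measure_ne_top_of_subset inter_subset_left (volume_betaCyl_ne_top β _)
  have hFG : ∀ v ∈ V, F v ⊆ G := by
    rintro v hv x ⟨hx, hx'⟩
    obtain ⟨v', hv'⟩ := (hV v hv).2
    refine hG x (betaCyl_append_subset β w v' ?_) hx'
    rw [← hv']
    exact betaCyl_append_subset β _ _ hx
  have hVcov : betaCyl β w ⊆ ⋃ v ∈ V, betaCyl β v := by
    intro x hx
    obtain ⟨v, hv, hxv⟩ := exists_mem_admissibleWords (β := β) hx.1 L
    have := exists_append_eq_of_mem_betaCyl hx hxv (by rw [hv.1]; exact hwL)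
    exact mem_iUnion₂.2 ⟨v, by simp [V, hv, this], hxv⟩
  have hterm : ∀ v ∈ V, volume (betaCyl β v) ≤
      ∑' i, ENNReal.ofReal (lam v) * volume (betaCyl β (c i) ∩ F v) := by
    intro v hv
    have hvol := (hK v (hV v hv).1.2).volume_inter_preimage hβ0 hX
    rw [List.length_append, List.length_replicate, (hV v hv).1.1, hr] at hvol
    have e : volume (betaCyl β v) = ENNReal.ofReal (lam v) * volume (F v) := by
      rw [← ENNReal.ofReal_toReal (hFtop v), ← ENNReal.ofReal_mul (hlam v), ← measureReal_def,
        hvol, ← ENNReal.ofReal_toReal (volume_betaCyl_ne_top β v), ← measureReal_def]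
      congr 1
      simp only [lam]
      field_simp
    rw [e, ENNReal.tsum_mul_left]
    gcongr
    refine (measure_mono ?_).trans (measure_iUnion_le _)
    rw [← iUnion_inter]
    exact subset_inter ((hFG v hv).trans hc) subset_rfl
  have hcell : ∀ i, ∑ v ∈ V, ENNReal.ofReal (lam v) * volume (betaCyl β (c i) ∩ F v) ≤
      volume (betaCyl β w) ^ (1 - s) * volume (betaCyl β (c i)) ^ s := by
    intro i
    have h := hK.measure_le hβ1 hs hs1 hX hr hr0 hA hXd hL hV (c i)
    have e : ∀ v, ENNReal.ofReal (lam v) * volume (betaCyl β (c i) ∩ F v) =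
        ENNReal.ofReal (lam v * volume.real (betaCyl β (c i) ∩ F v)) := by
      intro v
      rw [ENNReal.ofReal_mul (hlam v), measureReal_def, ENNReal.ofReal_toReal
        (measure_ne_top_of_subset inter_subset_right (hFtop v))]
    simp only [e]
    rw [← ENNReal.ofReal_sum_of_nonneg
      (fun v _ => mul_nonneg (hlam v) measureReal_nonneg)]
    refine (ENNReal.ofReal_le_ofReal h).trans_eq ?_
    rw [ENNReal.ofReal_mul (by positivity), ← ENNReal.ofReal_rpow_of_nonneg measureReal_nonneg
      (by linarith), ← ENNReal.ofReal_rpow_of_nonneg measureReal_nonneg hs.le, measureReal_def,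
      measureReal_def, ENNReal.ofReal_toReal hwtop,
      ENNReal.ofReal_toReal (volume_betaCyl_ne_top β _)]
  have hmain : volume (betaCyl β w) ≤
      volume (betaCyl β w) ^ (1 - s) * ∑' i, volume (betaCyl β (c i)) ^ s :=
    calc volume (betaCyl β w) ≤ ∑ v ∈ V, volume (betaCyl β v) :=
          (measure_mono hVcov).trans (measure_biUnion_finset_le _ _)
      _ ≤ ∑ v ∈ V, ∑' i, ENNReal.ofReal (lam v) * volume (betaCyl β (c i) ∩ F v) :=
          Finset.sum_le_sum hterm
      _ = ∑' i, ∑ v ∈ V, ENNReal.ofReal (lam v) * volume (betaCyl β (c i) ∩ F v) :=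
          (Summable.tsum_finsetSum fun _ _ => ENNReal.summable).symm
      _ ≤ ∑' i, volume (betaCyl β w) ^ (1 - s) * volume (betaCyl β (c i)) ^ s :=
          ENNReal.tsum_le_tsum hcell
      _ = _ := ENNReal.tsum_mul_left
  have hsplit : volume (betaCyl β w) =
      volume (betaCyl β w) ^ (1 - s) * volume (betaCyl β w) ^ s := by
    rw [← ENNReal.rpow_add _ _ hw0 hwtop, sub_add_cancel, ENNReal.rpow_one]
  nth_rewrite 1 [hsplit] at hmain
  refine (ENNReal.mul_le_mul_iff_right ?_ ?_).1 hmain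
  · exact (ENNReal.rpow_pos (pos_iff_ne_zero.2 hw0) hwtop).ne'
  · exact ENNReal.rpow_ne_top_of_nonneg (by linarith) hwtop

/-! ### Frequencies of words -/

/-- The number of occurrences of the word `w` at the first `N` positions of the expansion
of `x`. -/
def wordCount (β : ℝ) {m : ℕ} (w : Fin m → Fin 2) (x : ℝ) (N : ℕ) : ℕ :=
  ((Finset.range N).filter
      (fun i => ∀ k : Fin m, betaDigit β x (i + k) = ((w k : ℕ) : ℤ))).card

theorem wordCount_add (β : ℝ) {m : ℕ} (w : Fin m → Fin 2) (x : ℝ) (a b : ℕ) :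
    wordCount β w x (a + b) = wordCount β w x a + wordCount β w ((betaMap β)^[a] x) b := by
  simp only [wordCount, Finset.card_filter, Finset.sum_range_add, ← betaDigit_add, add_assoc]

theorem wordCount_le (β : ℝ) {m : ℕ} (w : Fin m → Fin 2) (x : ℝ) (N : ℕ) :
    wordCount β w x N ≤ N :=
  (Finset.card_filter_le _ _).trans_eq (Finset.card_range N)

theorem betaFreq_eq (β : ℝ) {m : ℕ} (w : Fin m → Fin 2) (x : ℝ) (n : ℕ) :
    betaFreq β w x n = (wordCount β w x (n - m) : ℝ) / ((n - m : ℕ) : ℝ) := rfl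

/-- The deviation of a word count from its expected value. -/
def countDev (β : ℝ) {m : ℕ} (w : Fin m → Fin 2) (q x : ℝ) (N : ℕ) : ℝ :=
  |(wordCount β w x N : ℝ) - q * N|

theorem countDev_add_le (β : ℝ) {m : ℕ} (w : Fin m → Fin 2) (q x : ℝ) (a b : ℕ) :
    countDev β w q x (a + b) ≤ countDev β w q x a + countDev β w q ((betaMap β)^[a] x) b := by
  unfold countDev
  rw [wordCount_add]
  push_cast
  refine le_trans (le_of_eq ?_) (abs_add_le _ _)
  congr 1
  ring

theorem countDev_le (β : ℝ) {m : ℕ} (w : Fin m → Fin 2) {q : ℝ} (hq0 : 0 ≤ q) (hq1 : q ≤ 1)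
    (x : ℝ) (N : ℕ) : countDev β w q x N ≤ N := by
  have h : (wordCount β w x N : ℝ) ≤ N := by exact_mod_cast wordCount_le β w x N
  have h0 : (0:ℝ) ≤ wordCount β w x N := by positivity
  have hN : (0:ℝ) ≤ N := by positivity
  rw [countDev, abs_le]
  constructor <;> nlinarith

theorem betaFreq_congr {β : ℝ} {m k : ℕ} (w : Fin m → Fin 2) {v : List ℤ} (hv : v.length = k)
    {x y : ℝ} (hx : x ∈ betaCyl β v) (hy : y ∈ betaCyl β v) :
    betaFreq β w x k = betaFreq β w y k := by
  unfold betaFreq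
  congr 3
  refine Finset.filter_congr fun i hi => forall_congr' fun q => ?_
  have hlt : i + q < v.length := by
    have := Finset.mem_range.1 hi
    have := q.2
    omega
  rw [(hx.2 _ hlt).trans (hy.2 _ hlt).symm]

theorem betaCyl_subset_betaGsetApprox {β ε : ℝ} {m k : ℕ} {p : (Fin m → Fin 2) → ℝ} {v : List ℤ}
    (hv : v.length = k) {x : ℝ} (hx : x ∈ betaCyl β v) (hxG : x ∈ betaGsetApprox β m p k ε) :
    betaCyl β v ⊆ betaGsetApprox β m p k ε := fun y hy =>
  ⟨hy.1, fun w => by rw [betaFreq_congr w hv hy hx]; exact hxG.2 w⟩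

theorem countDev_le_of_mem_betaGsetApprox {β ε : ℝ} {m k : ℕ} {p : (Fin m → Fin 2) → ℝ} {x : ℝ}
    (hx : x ∈ betaGsetApprox β m p k ε) (w : Fin m → Fin 2) :
    countDev β w (p w) x (k - m) ≤ ε * (k - m : ℕ) := by
  have h := (hx.2 w).le
  rw [betaFreq_eq] at h
  rcases Nat.eq_zero_or_pos (k - m) with h0 | h0
  · simp [h0, countDev, wordCount]
  · have h0' : (0:ℝ) < (k - m : ℕ) := by exact_mod_cast h0
    calc countDev β w (p w) x (k - m)
        = |(wordCount β w x (k - m) : ℝ) / (k - m : ℕ) - p w| * (k - m : ℕ) := by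
          rw [countDev, ← abs_of_pos h0', ← abs_mul, abs_of_pos h0', sub_mul,
            div_mul_cancel₀ _ h0'.ne']
      _ ≤ _ := by gcongr

theorem countDev_blockSet_le {β η : ℝ} {m k K : ℕ} {p : (Fin m → Fin 2) → ℝ}
    (hp0 : ∀ w, 0 ≤ p w) (hp1 : ∀ w, p w ≤ 1) (hη : 0 ≤ η) {𝒢 : Finset (List ℤ)}
    (hlen : ∀ u ∈ 𝒢, u.length = k + K)
    (h𝒢 : ∀ u ∈ 𝒢, betaCyl β u ⊆ betaGsetApprox β m p k η)
    (hmk : m ≤ k) (hη' : (m + K : ℝ) ≤ η * k) (w : Fin m → Fin 2) (j : ℕ) :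
    ∀ x ∈ blockSet β 𝒢 j, countDev β w (p w) x (j * (k + K)) ≤ j * (2 * η * (k + K : ℕ)) := by
  induction j with
  | zero => intro x _; simp [countDev, wordCount]
  | succ j ih =>
    intro x hx
    obtain ⟨u, hu, hxu, hx'⟩ := mem_iUnion₂.1 hx
    rw [mem_preimage, hlen u hu] at hx'
    have h1 := countDev_le_of_mem_betaGsetApprox (h𝒢 u hu hxu) w
    have h2 := countDev_add_le β w (p w) x (k - m) (m + K)
    have h3 := countDev_le β w (hp0 w) (hp1 w) ((betaMap β)^[k - m] x) (m + K)
    have h4 := countDev_add_le β w (p w) x (k + K) (j * (k + K))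
    have h5 := ih _ hx'
    rw [show k - m + (m + K) = k + K by omega] at h2
    rw [show (j + 1) * (k + K) = k + K + j * (k + K) by ring]
    have h6 : η * (k - m : ℕ) ≤ η * k := by
      gcongr
      omega
    have h7 : (0:ℝ) ≤ η * K := by positivity
    push_cast at *
    linarith

theorem mem_betaGsetApprox_of_blockSet {β ε : ℝ} {m k l : ℕ} {p : (Fin m → Fin 2) → ℝ}
    (hp0 : ∀ w, 0 ≤ p w) (hp1 : ∀ w, p w ≤ 1) (hk : 0 < k) {𝒢 : Finset (List ℤ)}
    (hdev : ∀ w : Fin m → Fin 2, ∀ j, ∀ x ∈ blockSet β 𝒢 j,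
      countDev β w (p w) x (j * k) ≤ j * (ε / 2 * k))
    {n : ℕ} (hn : m + l < n) (hε : 0 < ε) (hnl : (l + k : ℝ) < ε / 2 * (n - m : ℕ)) {x : ℝ}
    (hx : x ∈ Ico (0:ℝ) 1) (hxl : (betaMap β)^[l] x ∈ blockSet β 𝒢 ((n - m - l) / k)) :
    x ∈ betaGsetApprox β m p n ε := by
  refine ⟨hx, fun w => ?_⟩
  set N := n - m with hN
  set j := (N - l) / k with hj
  set r := (N - l) % k with hr
  have hNj : N = l + (j * k + r) := by
    have : j * k + r = N - l := Nat.div_add_mod' (N - l) k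
    omega
  have hrk : r < k := Nat.mod_lt _ hk
  have hdecomp := countDev_add_le β w (p w) x l (j * k + r)
  have h2 := countDev_add_le β w (p w) ((betaMap β)^[l] x) (j * k) r
  have h3 := countDev_le β w (hp0 w) (hp1 w) x l
  have h4 := countDev_le β w (hp0 w) (hp1 w) ((betaMap β)^[j * k] ((betaMap β)^[l] x)) r
  have h5 := hdev w j _ hxl
  rw [← hNj] at hdecomp
  have hjk : (j * k : ℝ) ≤ N := by exact_mod_cast (by omega : j * k ≤ N)
  have hrk' : (r : ℝ) ≤ k := by exact_mod_cast hrk.le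
  have h6 : ε / 2 * (j * k) ≤ ε / 2 * N := by gcongr
  have hlt : countDev β w (p w) x N < ε * N := by linarith
  have hNpos : (0:ℝ) < N := by
    have : 0 < N := by omega
    exact_mod_cast this
  rw [betaFreq_eq, ← hN]
  calc _ = countDev β w (p w) x N / N := by
        rw [countDev, ← abs_of_pos hNpos, ← abs_div, abs_of_pos hNpos, sub_div,
          mul_div_cancel_right₀ _ hNpos.ne']
    _ < ε := by rwa [div_lt_iff₀ hNpos]

/-! ### Counting typical cylinders -/

/-- The words of length `k` whose cylinders consist of `ε`-typical points. -/
def typicalWords (β : ℝ) {m : ℕ} (p : (Fin m → Fin 2) → ℝ) (k : ℕ) (ε : ℝ) : Set (List ℤ) :=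
  {v ∈ admissibleWords β k | betaCyl β v ⊆ betaGsetApprox β m p k ε}

theorem exists_le_card_typicalWords {β : ℝ} (hβ1 : 1 < β) (hβ2 : β < 2) {m : ℕ}
    {p : (Fin m → Fin 2) → ℝ} {s ε : ℝ} (hε : 0 < ε) (hs0 : 0 ≤ s)
    (hs : ENNReal.ofReal s < dimH (betaGset β m p)) (M : ℝ) (k₀ : ℕ) :
    ∃ k ≥ k₀, M * (β ^ k) ^ s ≤ (typicalWords β p k ε).ncard := by
  by_contra! hcon
  have hfin : ∀ k, (typicalWords β p k ε).Finite := fun k =>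
    (finite_admissibleWords hβ1 hβ2 k).subset fun v hv => hv.1
  let E : ℕ → Set ℝ := fun N => {x ∈ Ico (0:ℝ) 1 | ∀ k ≥ N, x ∈ betaGsetApprox β m p k ε}
  have hsub : betaGset β m p ⊆ ⋃ N, E N := by
    rintro x ⟨hx, h⟩
    have : ∀ᶠ n in atTop, ∀ w, |betaFreq β w x n - p w| < ε := by
      rw [eventually_all]
      intro w
      have := (Metric.tendsto_nhds.1 (h w)) ε hε
      simpa [Real.dist_eq] using this
    obtain ⟨N, hN⟩ := eventually_atTop.1 this
    exact mem_iUnion.2 ⟨N, hx, fun k hk => ⟨hx, hN k hk⟩⟩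
  have hdim := hs.trans_le (dimH_mono hsub)
  rw [dimH_iUnion, lt_iSup_iff] at hdim
  obtain ⟨N, hN⟩ := hdim
  have htop := hausdorffMeasure_of_lt_dimH (d := s.toNNReal) hN
  rw [Real.coe_toNNReal s hs0] at htop
  have : ∀ k, Fintype (typicalWords β p k ε) := fun k => (hfin k).fintype
  have hle := Measure.hausdorffMeasure_le_liminf_sum (X := ℝ) s (E N) (l := atTop)
    (ι := fun k => typicalWords β p k ε) (fun k : ℕ => ENNReal.ofReal (β ^ k)⁻¹) ?_
    (fun k v => betaCyl β v) ?_ ?_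
  · rw [htop, top_le_iff] at hle
    have hbound : liminf (fun k => ∑ v : typicalWords β p k ε, Metric.ediam (betaCyl β v) ^ s)
        atTop ≤ ENNReal.ofReal M := by
      refine (liminf_le_liminf (v := fun _ => ENNReal.ofReal M) ?_).trans_eq (liminf_const _)
      filter_upwards [eventually_ge_atTop k₀] with k hk
      have hp : 0 < β ^ k := by positivity
      calc _ ≤ ∑ v : typicalWords β p k ε, (ENNReal.ofReal (β ^ k)⁻¹) ^ s := by
            refine Finset.sum_le_sum fun v _ => ?_
            refine ENNReal.rpow_le_rpow ?_ hs0
            have := ediam_betaCyl_le hβ1 (v : List ℤ)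
            rwa [v.2.1.1] at this
        _ = (typicalWords β p k ε).ncard * ENNReal.ofReal (((β ^ k)⁻¹) ^ s) := by
            rw [Finset.sum_const, nsmul_eq_mul, Finset.card_univ, ← Nat.card_eq_fintype_card,
              Nat.card_coe_set_eq, ENNReal.ofReal_rpow_of_nonneg (by positivity) hs0]
        _ = ENNReal.ofReal ((typicalWords β p k ε).ncard * ((β ^ k)⁻¹) ^ s) := by
            rw [ENNReal.ofReal_mul (by positivity), ENNReal.ofReal_natCast]
        _ ≤ ENNReal.ofReal M := by
            refine ENNReal.ofReal_le_ofReal ?_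
            rw [Real.inv_rpow hp.le, ← div_eq_mul_inv, div_le_iff₀ (by positivity)]
            exact (hcon k hk).le
    rw [hle] at hbound
    exact absurd hbound (by simp)
  · rw [← ENNReal.ofReal_zero]
    refine ENNReal.tendsto_ofReal ?_
    simp only [← inv_pow]
    exact tendsto_pow_atTop_nhds_zero_of_lt_one (by positivity) (inv_lt_one_of_one_lt₀ hβ1)
  · refine Eventually.of_forall fun k v => ?_
    have := ediam_betaCyl_le hβ1 (v : List ℤ)
    rwa [v.2.1.1] at this
  · filter_upwards [eventually_ge_atTop N] with k hk x hx
    obtain ⟨v, hv, hxv⟩ := exists_mem_admissibleWords (β := β) hx.1 k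
    exact mem_iUnion.2
      ⟨⟨v, hv, betaCyl_subset_betaGsetApprox hv.1 hxv (hx.2 k hk)⟩, hxv⟩

/-- Eventually the cylinder content of the typical part of a cylinder is as large as that of the
cylinder itself. -/
theorem eventually_le_betaCylMeasure {β : ℝ} (hβ1 : 1 < β) (hβ2 : β < 2)
    (hterm : TerminatesAtOne β) {m : ℕ} {p : (Fin m → Fin 2) → ℝ} (hp : IsProbVector p)
    {ε : ℝ} (hε : 0 < ε) (w : List ℤ) {s : ℝ} (hs0 : 0 < s)
    (hs : ENNReal.ofReal s < dimH (betaGset β m p)) :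
    ∀ᶠ n in atTop, volume (betaCyl β w) ^ s ≤
      betaCylMeasure β s (betaCyl β w ∩ betaGsetApprox β m p n ε) := by
  have hβ0 : 0 < β := by linarith
  rcases eq_or_ne (volume (betaCyl β w)) 0 with hw0 | hw0
  · simp [hw0, hs0]
  have hwpos : 0 < volume.real (betaCyl β w) :=
    ENNReal.toReal_pos hw0 (volume_betaCyl_ne_top β w)
  have hs1 : s < 1 := by
    have h := hs.trans_le ((dimH_mono (subset_univ _)).trans_eq Real.dimH_univ)
    simpa using h
  have hp1 : ∀ w, p w ≤ 1 := fun w =>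
    hp.2 ▸ Finset.single_le_sum (f := p) (fun i _ => hp.1 i) (Finset.mem_univ w)
  obtain ⟨K, hK⟩ := exists_zerosFill hβ1 hterm
  obtain ⟨k₁, hk₁⟩ := exists_nat_ge ((m + K : ℝ) / (ε / 4))
  obtain ⟨k, hk, hcard⟩ := exists_le_card_typicalWords hβ1 hβ2 (ε := ε / 4) (by linarith) hs0.le hs
    ((β ^ K) ^ s) (max k₁ (m + 1))
  have hfin : (typicalWords β p k (ε / 4)).Finite :=
    (finite_admissibleWords hβ1 hβ2 k).subset fun v hv => hv.1
  let 𝒢 : Finset (List ℤ) := hfin.toFinset.image (fun v => v ++ List.replicate K 0)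
  have h𝒢 : ∀ u ∈ 𝒢, ∃ v ∈ typicalWords β p k (ε / 4), v ++ List.replicate K 0 = u := by
    intro u hu
    simpa [𝒢] using hu
  have hlen : ∀ u ∈ 𝒢, u.length = k + K := by
    intro u hu
    obtain ⟨v, hv, rfl⟩ := h𝒢 u hu
    rw [List.length_append, List.length_replicate, hv.1.1]
  have hfull : ∀ u ∈ 𝒢, IsBranch β u 1 := by
    intro u hu
    obtain ⟨v, hv, rfl⟩ := h𝒢 u hu
    exact hK v hv.1.2
  have htyp : ∀ u ∈ 𝒢, betaCyl β u ⊆ betaGsetApprox β m p k (ε / 4) := by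
    intro u hu
    obtain ⟨v, hv, rfl⟩ := h𝒢 u hu
    exact (betaCyl_append_subset β _ _).trans hv.2
  have hcard' : (β ^ (k + K)) ^ s ≤ 𝒢.card := by
    rw [Finset.card_image_of_injective _ (fun a b h => List.append_cancel_right h),
      ← Set.ncard_eq_toFinset_card _ hfin, pow_add, Real.mul_rpow (by positivity) (by positivity),
      mul_comm]
    exact hcard
  have hcpos : (0:ℝ) < 𝒢.card := lt_of_lt_of_le (by positivity) hcard'
  have hkm : m + 1 ≤ k := (le_max_right _ _).trans hk
  have hk₁' : (m + K : ℝ) ≤ ε / 4 * k := by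
    rw [← div_le_iff₀' (by linarith)]
    refine hk₁.trans ?_
    exact_mod_cast (le_max_left _ _).trans hk
  have hdev : ∀ w : Fin m → Fin 2, ∀ j, ∀ x ∈ blockSet β 𝒢 j,
      countDev β w (p w) x (j * (k + K)) ≤ j * (ε / 2 * (k + K : ℕ)) := by
    intro w j x hx
    have := countDev_blockSet_le hp.1 hp1 (by linarith) hlen htyp (by omega) hk₁' w j x hx
    convert this using 3
    ring
  set A : ℝ := (β ^ (k + K + K)) ^ s with hA
  have hAK : (β ^ K) ^ s ≤ A := by
    rw [hA]
    gcongr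
    · exact hβ1.le
    · omega
  obtain ⟨L, hwL, hL⟩ : ∃ L ≥ w.length,
      A * (β ^ K) ^ s * ((β ^ L)⁻¹) ^ (1 - s) ≤ volume.real (betaCyl β w) ^ (1 - s) := by
    have hlim : Tendsto (fun L : ℕ => A * (β ^ K) ^ s * ((β ^ L)⁻¹) ^ (1 - s)) atTop (nhds 0) := by
      have h1 : Tendsto (fun L : ℕ => (β ^ L)⁻¹) atTop (nhds 0) := by
        simp only [← inv_pow]
        exact tendsto_pow_atTop_nhds_zero_of_lt_one (by positivity) (inv_lt_one_of_one_lt₀ hβ1)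
      have h2 := (h1.rpow_const (p := 1 - s) (Or.inr (by linarith))).const_mul (A * (β ^ K) ^ s)
      rwa [Real.zero_rpow (by linarith), mul_zero] at h2
    have hev := hlim.eventually_le_const
      (show 0 < volume.real (betaCyl β w) ^ (1 - s) by positivity)
    obtain ⟨L, hL⟩ := ((eventually_ge_atTop w.length).and hev).exists
    exact ⟨L, hL.1, hL.2⟩
  have hlarge : Tendsto (fun n : ℕ => ε / 2 * ((n - m : ℕ) : ℝ)) atTop atTop :=
    (tendsto_natCast_atTop_atTop.comp (tendsto_sub_atTop_nat m)).const_mul_atTop (by linarith)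
  filter_upwards [eventually_gt_atTop (m + (L + K)),
    hlarge.eventually_gt_atTop (((L + K : ℕ) : ℝ) + (k + K : ℕ))] with n hn hn'
  refine hK.le_betaCylMeasure hβ1 hβ2 hs0 hs1 hwL
    (blockSet_subset β 𝒢 ((n - m - (L + K)) / (k + K)))
    (volume_blockSet hβ0 hlen hfull _) (by positivity) hAK
    (volume_inter_blockSet_le hβ1 hK hs0.le hs1.le hlen hfull hcard' hA.ge _) hL ?_
  intro x hxw hx
  exact ⟨hxw, mem_betaGsetApprox_of_blockSet hp.1 hp1 (by omega) hdev hn hε hn' hxw.1 hx⟩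

theorem betaCylMeasure_zero (β : ℝ) (A : Set ℝ) : betaCylMeasure β 0 A = ⊤ := by
  simp [betaCylMeasure]

theorem one_le_two_mul_Qconst {β s : ℝ} (hβ : 1 < β) (hs : 0 < s) :
    1 ≤ 2 * β ^ s * Qconst s β := by
  have hβ0 : 0 < β := by linarith
  have h0 : 0 < 1 - 1 / β := by
    rw [sub_pos, div_lt_one hβ0]; exact hβ
  have h1 : 1 - 1 / β < 1 := by
    have : 0 < 1 / β := by positivity
    linarith
  have hsum : Summable (fun i : ℕ => ((1 - 1 / β) ^ i) ^ s) := by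
    have : ∀ i : ℕ, ((1 - 1 / β) ^ i) ^ s = ((1 - 1 / β) ^ s) ^ i := by
      intro i
      rw [← Real.rpow_natCast, ← Real.rpow_mul h0.le, mul_comm, Real.rpow_mul h0.le,
        Real.rpow_natCast]
    simp only [this]
    exact summable_geometric_of_lt_one (by positivity) (Real.rpow_lt_one h0.le h1 hs)
  have hge := hsum.le_tsum 0 (fun i _ => by positivity)
  rw [pow_zero, Real.one_rpow] at hge
  rw [Qconst, Real.rpow_neg hβ0.le]
  have hp : 0 < β ^ s := by positivity
  rw [mul_assoc, ← mul_assoc (β ^ s), mul_inv_cancel₀ hp.ne', one_mul]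
  linarith

/-- for `β ∈ (1,2)` with terminating expansion of `1`, every cylinder
`C`, and `0 ≤ s < dim_H G^{β,m}_{p̄}`,
`liminf_n N^s_∞(C ∩ G^{β,m}_{p̄}(n,ε)) ≥ |C|^s / (2 β^s Q(s,β))`. -/
theorem liminf_betaCylMeasure_cylinder (β : ℝ) (hβ1 : 1 < β) (hβ2 : β < 2)
    (hterm : TerminatesAtOne β)
    (m : ℕ) (hm : 0 < m) (p : (Fin m → Fin 2) → ℝ) (hp : IsProbVector p)
    (ε : ℝ) (hε : 0 < ε) (w : List ℤ)
    (s : ℝ) (hs0 : 0 ≤ s) (hs : ENNReal.ofReal s < dimH (betaGset β m p)) :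
    volume (betaCyl β w) ^ s / ENNReal.ofReal (2 * β ^ s * Qconst s β)
      ≤ atTop.liminf (fun n => betaCylMeasure β s (betaCyl β w ∩ betaGsetApprox β m p n ε)) := by
  rcases hs0.eq_or_lt with rfl | hs0
  · simp [betaCylMeasure_zero]
  · refine le_liminf_of_le (h := ?_)
    filter_upwards [eventually_le_betaCylMeasure hβ1 hβ2 hterm hp hε w hs0 hs] with n hn
    refine le_trans (ENNReal.div_le_of_le_mul ?_) hn
    refine le_mul_of_one_le_right' ?_
    rw [ENNReal.one_le_ofReal]
    exact one_le_two_mul_Qconst hβ1 hs0
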